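/- arXiv:2601.16415 — 6 statements merged into one kernel-verified Lean document; each statement's English description precedes it below -/
import Mathlib

section
/- Let 𝒦 be a simplicial complex on a finite set S and let Γ be a 𝒦-stable graph. Assume that either Γ has at least one edge or 𝒦 is at least triparted. Then for every vertex v ∈ V(Γ) with g(v) = 0, the simplicial complex 𝒦(v) on H(v) is at least triparted, i.e. every partition of H(v) into nonempty elements of 𝒦(v) has at least 3 parts. -/
/-- An (abstract) simplicial complex on a finite set `S`: a collection of subsets of `S`
containing the empty set and all singletons, closed under taking subsets. -/
structure AbsSimplicialComplex (S : Type) [Fintype S] [DecidableEq S] where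
  faces : Set (Finset S)
  empty_mem : ∅ ∈ faces
  singleton_mem : ∀ s : S, {s} ∈ faces
  down_closed : ∀ ⦃A B : Finset S⦄, A ∈ faces → B ⊆ A → B ∈ faces

/-- A family of subsets of `X` is "at least triparted" if every partition of `X`
into nonempty members of the family has at least 3 parts. -/
def TripartedFam {X : Type} [Fintype X] [DecidableEq X] (F : Set (Finset X)) : Prop :=
  ∀ P : Finset (Finset X),
    (∀ A ∈ P, A.Nonempty) →
    (∀ A ∈ P, A ∈ F) →
    (∀ A ∈ P, ∀ B ∈ P, A ≠ B → Disjoint A B) →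
    P.sup id = Finset.univ →
    3 ≤ P.card

/-- A simplicial complex is at least triparted if its family of faces is. -/
def AbsSimplicialComplex.Triparted {S : Type} [Fintype S] [DecidableEq S]
    (K : AbsSimplicialComplex S) : Prop :=
  TripartedFam K.faces

/-- A `𝒦`-stable graph for a simplicial complex `𝒦` on a finite marking set `S`. -/
structure KStableGraph (S : Type) [Fintype S] [DecidableEq S]
    (K : AbsSimplicialComplex S) where
  /-- vertex set -/
  V : Type
  /-- set of half-edges -/
  H : Type
  [fintypeV : Fintype V]
  [fintypeH : Fintype H]
  [decEqV : DecidableEq V]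
  [decEqH : DecidableEq H]
  /-- genus function -/
  g : V → ℕ
  /-- attaching map of half-edges to vertices -/
  f : H → V
  /-- the involution whose 2-element orbits are the edges and whose fixed points are legs -/
  ι : H → H
  ι_invol : Function.Involutive ι
  /-- the labeling map from the marking set to the legs -/
  leg : S → H
  leg_fixed : ∀ s : S, ι (leg s) = leg s
  leg_surj : ∀ h : H, ι h = h → ∃ s : S, leg s = h
  /-- (1) the underlying (multi)graph, with an edge between `f h` and `f (ι h)` for each
  2-element orbit `{h, ι h}`, is connected -/
  conn : (SimpleGraph.fromRel (fun v w : V => ∃ h : H, f h = v ∧ f (ι h) = w)).Connected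
  /-- (2) the fiber of the labeling map over any leg is a face of `𝒦` -/
  fiber_mem : ∀ h : H, ι h = h →
    (Finset.univ.filter (fun s : S => leg s = h)) ∈ K.faces
  /-- (3) for every leaf `v` (a vertex incident to at most one edge, i.e. carrying at most
  two non-fixed half-edges of edges meeting `v`), the set of markings at `v` is not a face -/
  leaf_cond : ∀ v : V,
    (Finset.univ.filter (fun h : H => ι h ≠ h ∧ (f h = v ∨ f (ι h) = v))).card ≤ 2 →
    (Finset.univ.filter (fun s : S => f (leg s) = v)) ∉ K.faces
  /-- (4) stability: `2 g(v) − 2 + n(v) > 0` for every vertex `v` -/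
  stable : ∀ v : V,
    0 < 2 * (g v : ℤ) - 2 + ((Finset.univ.filter (fun h : H => f h = v)).card : ℤ)

attribute [instance] KStableGraph.fintypeV KStableGraph.fintypeH
attribute [instance] KStableGraph.decEqV KStableGraph.decEqH

namespace KStableGraph

variable {S : Type} [Fintype S] [DecidableEq S] {K : AbsSimplicialComplex S}

/-- The number of edges: half the number of non-fixed half-edges. -/
def numEdges (Γ : KStableGraph S K) : ℕ :=
  (Finset.univ.filter (fun h : Γ.H => Γ.ι h ≠ h)).card / 2

/-- The labeling map, viewed as a map to the set of legs (fixed points of `ι`). -/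
def legFix (Γ : KStableGraph S K) : S → {h : Γ.H // Γ.ι h = h} :=
  fun s => ⟨Γ.leg s, Γ.leg_fixed s⟩

/-- A `𝒦`-stable graph has genus `0` if all its vertices have genus `0` and its underlying
multigraph is a tree, i.e. (being already connected) `#V = #E + 1`. -/
def GenusZero (Γ : KStableGraph S K) : Prop :=
  (∀ v : Γ.V, Γ.g v = 0) ∧ Fintype.card Γ.V = Γ.numEdges + 1

end KStableGraph

namespace KStableGraph

variable {S : Type} [Fintype S] [DecidableEq S] {K : AbsSimplicialComplex S}

/-- The simplicial complex `𝒦(v)` on the set `H(v)` of half-edges at a vertex `v`: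
its faces are the empty set, the singletons, and the subsets `A` of `H(v) ∩ H^ι`
such that `{s ∈ S : ℓ(s) ∈ A} ∈ 𝒦`. -/
def Kv (Γ : KStableGraph S K) (v : Γ.V) :
    AbsSimplicialComplex {h : Γ.H // Γ.f h = v} where
  faces := {A | A.card ≤ 1 ∨ ((∀ x ∈ A, Γ.ι x.1 = x.1) ∧
      Finset.univ.filter (fun s : S => ∃ x ∈ A, x.1 = Γ.leg s) ∈ K.faces)}
  empty_mem := Or.inl (by simp)
  singleton_mem x := Or.inl (by simp)
  down_closed := by
    rintro A B (hA | ⟨hfix, hmem⟩) hBA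
    · exact Or.inl (le_trans (Finset.card_le_card hBA) hA)
    · refine Or.inr ⟨fun x hx => hfix x (hBA hx), K.down_closed hmem ?_⟩
      intro s hs
      simp only [Finset.mem_filter] at hs ⊢
      obtain ⟨hsu, x, hxB, hxe⟩ := hs
      exact ⟨hsu, x, hBA hxB, hxe⟩

end KStableGraph

/-- If `Γ` is a `𝒦`-stable graph which either has at least one edge or for which `𝒦` is
at least triparted, then for every vertex `v` of genus `0`, the simplicial complex
`𝒦(v)` on `H(v)` is at least triparted. -/
theorem Kv_triparted {S : Type} [Fintype S] [DecidableEq S] {K : AbsSimplicialComplex S}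
    (Γ : KStableGraph S K)
    (hyp : 1 ≤ Γ.numEdges ∨ K.Triparted)
    (v : Γ.V) (hv : Γ.g v = 0) :
    (Γ.Kv v).Triparted := by
  classical
  intro P hne hF hdisj hsup
  by_contra hlt
  have hP : P.card ≤ 2 := by omega
  have hcov : ∀ x : {h : Γ.H // Γ.f h = v}, ∃ A ∈ P, x ∈ A := by
    intro x
    have hx : x ∈ P.sup id := by rw [hsup]; exact Finset.mem_univ x
    simpa [Finset.mem_sup] using hx
  have hcard : 3 ≤ (Finset.univ : Finset {h : Γ.H // Γ.f h = v}).card := by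
    have h1 := Γ.stable v
    rw [hv] at h1
    rw [Finset.card_univ, Fintype.card_subtype]
    push_cast at h1
    omega
  by_cases hE : ∃ h : Γ.H, Γ.f h = v ∧ Γ.ι h ≠ h
  · obtain ⟨h0, hf0, hi0⟩ := hE
    obtain ⟨A0, hA0, hx0⟩ := hcov ⟨h0, hf0⟩
    have hA0c : A0.card ≤ 1 := by
      rcases hF A0 hA0 with h | h
      · exact h
      · exact absurd (h.1 _ hx0) hi0
    have hA0mem : ∀ y ∈ A0, y = ⟨h0, hf0⟩ := fun y hy =>
      Finset.card_le_one.1 hA0c y hy _ hx0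
    have her : (P.erase A0).card ≤ 1 := by
      rw [Finset.card_erase_of_mem hA0]; omega
    have herase : 2 ≤ ((Finset.univ : Finset {h : Γ.H // Γ.f h = v}).erase ⟨h0, hf0⟩).card := by
      rw [Finset.card_erase_of_mem (Finset.mem_univ _)]; omega
    obtain ⟨x, hx⟩ : ((Finset.univ : Finset {h : Γ.H // Γ.f h = v}).erase ⟨h0, hf0⟩).Nonempty := by
      rw [← Finset.card_pos]; omega
    have hxne := Finset.ne_of_mem_erase hx
    obtain ⟨B, hB, hxB⟩ := hcov x
    have hBA : B ≠ A0 := fun h => hxne (hA0mem x (h ▸ hxB))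
    have hall : ∀ y, y ≠ ⟨h0, hf0⟩ → y ∈ B := by
      intro y hy
      obtain ⟨C, hC, hyC⟩ := hcov y
      have hCA : C ≠ A0 := fun h => hy (hA0mem y (h ▸ hyC))
      have : C = B := Finset.card_le_one.1 her C (Finset.mem_erase.2 ⟨hCA, hC⟩) B
        (Finset.mem_erase.2 ⟨hBA, hB⟩)
      exact this ▸ hyC
    have hBc : 2 ≤ B.card :=
      herase.trans (Finset.card_le_card fun y hy => hall y (Finset.ne_of_mem_erase hy))
    rcases hF B hB with h | ⟨hfix, hmem⟩
    · omega
    · have hat : ∀ h : Γ.H, Γ.ι h ≠ h → Γ.f h = v → h = h0 := by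
        intro h hi hf
        by_contra hn
        exact hi (hfix ⟨h, hf⟩ (hall ⟨h, hf⟩ (fun e => hn (congrArg Subtype.val e))))
      refine Γ.leaf_cond v ?_ (K.down_closed hmem ?_)
      · refine (Finset.card_le_card (t := {h0, Γ.ι h0}) ?_).trans Finset.card_le_two
        intro h hh
        simp only [Finset.mem_filter, Finset.mem_univ, true_and] at hh
        obtain ⟨hi, hf | hf⟩ := hh
        · simp [hat h hi hf]
        · have : Γ.ι h = h0 := hat _ (fun e => hi (Γ.ι_invol.injective e)) hf
          simp [← this, Γ.ι_invol h]
      · intro s hs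
        simp only [Finset.mem_filter, Finset.mem_univ, true_and] at hs ⊢
        refine ⟨⟨Γ.leg s, hs⟩, hall _ (fun e => ?_), rfl⟩
        have e' : Γ.leg s = h0 := congrArg Subtype.val e
        exact hi0 (e' ▸ Γ.leg_fixed s)
  · push Not at hE
    have hV : ∀ w, w = v := by
      intro w
      by_contra hw
      obtain ⟨p⟩ := Γ.conn.preconnected v w
      cases p with
      | nil => exact hw rfl
      | cons hadj _ =>
        rw [SimpleGraph.fromRel_adj] at hadj
        obtain ⟨hn, ⟨h, h1, h2⟩ | ⟨h, h1, h2⟩⟩ := hadj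
        · rw [hE h h1, h1] at h2; exact hn h2
        · have := hE _ h2
          rw [Γ.ι_invol h] at this
          rw [← this] at h2
          exact hn (h2.symm.trans h1)
    rcases hyp with hyp | hyp
    · have : (Finset.univ.filter (fun h : Γ.H => Γ.ι h ≠ h)) = ∅ := by
        apply Finset.filter_eq_empty_iff.2
        intro h _ hn
        exact hn (hE h (hV _))
      unfold KStableGraph.numEdges at hyp
      rw [this] at hyp
      simp at hyp
    · let pre : Finset {h : Γ.H // Γ.f h = v} → Finset S := fun A =>
        Finset.univ.filter (fun s : S => ∃ x ∈ A, x.1 = Γ.leg s)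
      have hpre : ∀ A s, s ∈ pre A ↔ ∃ x ∈ A, x.1 = Γ.leg s := by
        intro A s; simp [pre]
      have key : 3 ≤ ((P.image pre).erase ∅).card := by
        apply hyp
        · intro A hA
          exact Finset.nonempty_iff_ne_empty.2 (Finset.ne_of_mem_erase hA)
        · intro A hA
          obtain ⟨B, hB, rfl⟩ := Finset.mem_image.1 (Finset.mem_of_mem_erase hA)
          rcases hF B hB with h | h
          · obtain ⟨x, hx⟩ := hne B hB
            refine K.down_closed (Γ.fiber_mem x.1 (hE _ x.2)) ?_
            intro s hs
            obtain ⟨y, hy, hys⟩ := (hpre B s).1 hs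
            have : y = x := Finset.card_le_one.1 h y hy x hx
            simp [← hys, this]
          · exact h.2
        · intro A hA B hB hAB
          obtain ⟨A', hA', rfl⟩ := Finset.mem_image.1 (Finset.mem_of_mem_erase hA)
          obtain ⟨B', hB', rfl⟩ := Finset.mem_image.1 (Finset.mem_of_mem_erase hB)
          have hd := hdisj A' hA' B' hB' (fun e => hAB (congrArg pre e))
          rw [Finset.disjoint_left] at hd ⊢
          intro s hs hs'
          obtain ⟨x, hx, hxs⟩ := (hpre _ s).1 hs
          obtain ⟨y, hy, hys⟩ := (hpre _ s).1 hs'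
          have : x = y := Subtype.ext (hxs.trans hys.symm)
          exact hd hx (this ▸ hy)
        · apply Finset.eq_univ_of_forall
          intro s
          obtain ⟨A, hA, hsA⟩ := hcov ⟨Γ.leg s, hV _⟩
          have hs : s ∈ pre A := (hpre A s).2 ⟨_, hsA, rfl⟩
          rw [Finset.mem_sup]
          exact ⟨pre A, Finset.mem_erase.2 ⟨Finset.ne_empty_of_mem hs,
            Finset.mem_image_of_mem _ hA⟩, hs⟩
      have h1 := Finset.card_erase_le (s := P.image pre) (a := ∅)
      have h2 := Finset.card_image_le (s := P) (f := pre)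
      omega
end

section
/- Let 𝒦 be an at least triparted simplicial complex on a finite set S, let T be a finite set, and let ℓ : S → T be a surjection such that ℓ⁻¹(t) ∈ 𝒦 for every t ∈ T. Then the collection 𝒥 := {A ⊆ T : ℓ⁻¹(A) ∈ 𝒦} is a simplicial complex on T (it contains the empty set and all singletons and is closed under subsets) and 𝒥 is at least triparted. -/
/-- If `𝒦` is an at least triparted simplicial complex on `S` and `ℓ : S → T` is a surjection
all of whose fibers are faces of `𝒦`, then `𝒥 := {A ⊆ T : ℓ⁻¹(A) ∈ 𝒦}` is a simplicial
complex on `T` (contains the empty set and all singletons, and is closed under subsets),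
and `𝒥` is at least triparted. -/
theorem pushforward_triparted {S T : Type} [Fintype S] [DecidableEq S]
    [Fintype T] [DecidableEq T]
    (K : AbsSimplicialComplex S) (hK : K.Triparted)
    (ℓ : S → T) (hsurj : Function.Surjective ℓ)
    (hfib : ∀ t : T, Finset.univ.filter (fun s : S => ℓ s = t) ∈ K.faces)
    (J : Set (Finset T))
    (hJ : J = {A : Finset T | Finset.univ.filter (fun s : S => ℓ s ∈ A) ∈ K.faces}) :
    (∅ ∈ J) ∧
    (∀ t : T, {t} ∈ J) ∧
    (∀ ⦃A B : Finset T⦄, A ∈ J → B ⊆ A → B ∈ J) ∧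
    TripartedFam J := by
  subst hJ
  refine ⟨?_, ?_, ?_, ?_⟩
  · simpa using K.empty_mem
  · intro t
    simpa using hfib t
  · intro A B hA hBA
    refine K.down_closed hA ?_
    intro s hs
    simp only [Finset.mem_filter, Finset.mem_univ, true_and] at hs ⊢
    exact hBA hs
  · intro P hne hF hdis hsup
    refine le_trans (hK (P.image fun A => Finset.univ.filter (fun s : S => ℓ s ∈ A))
      ?_ ?_ ?_ ?_) Finset.card_image_le
    · intro A' hA'
      obtain ⟨A, hA, rfl⟩ := Finset.mem_image.1 hA'
      obtain ⟨t, ht⟩ := hne A hA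
      obtain ⟨s, rfl⟩ := hsurj t
      exact ⟨s, by simpa using ht⟩
    · intro A' hA'
      obtain ⟨A, hA, rfl⟩ := Finset.mem_image.1 hA'
      exact hF A hA
    · intro A' hA' B' hB' hAB
      obtain ⟨A, hA, rfl⟩ := Finset.mem_image.1 hA'
      obtain ⟨B, hB, rfl⟩ := Finset.mem_image.1 hB'
      have hd := hdis A hA B hB (fun h => hAB (by rw [h]))
      rw [Finset.disjoint_left] at hd ⊢
      intro s hs hs2
      simp only [Finset.mem_filter, Finset.mem_univ, true_and] at hs hs2
      exact hd hs hs2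
    · ext s
      have h : ℓ s ∈ P.sup id := by rw [hsup]; exact Finset.mem_univ _
      obtain ⟨A, hA, hs⟩ := Finset.mem_sup.1 h
      refine ⟨fun _ => Finset.mem_univ _, fun _ => Finset.mem_sup.2 ⟨_, Finset.mem_image_of_mem _ hA, ?_⟩⟩
      simpa using hs
end

section
/- Let 𝒦 be a simplicial complex on a finite set S and let Γ be a genus-0 𝒦-stable graph of codimension 1, i.e. with #E(Γ) + #S − #H^ι = 1. Then exactly one of the following holds: (a) Γ has exactly two vertices and exactly one edge, and ℓ : S → H^ι is a bijection; or (b) Γ has exactly one vertex and no edges, and there exist distinct s, t ∈ S with ℓ(s) = ℓ(t) such that the restriction of ℓ to S ∖ {t} is injective (equivalently, exactly one fiber of ℓ has two elements and all other fibers are singletons). -/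
/-- A genus-0 `𝒦`-stable graph of codimension 1 (i.e. with `#E(Γ) + #S − #H^ι = 1`)
is of exactly one of the following two shapes:
(a) two vertices, one edge, and `ℓ : S → H^ι` a bijection; or
(b) one vertex, no edges, and exactly one fiber of `ℓ` has two elements while all other
fibers are singletons. -/
theorem codim_one_dichotomy {S : Type} [Fintype S] [DecidableEq S]
    {K : AbsSimplicialComplex S} (Γ : KStableGraph S K) (h0 : Γ.GenusZero)
    (hcodim : Γ.numEdges + Fintype.card S = Fintype.card {h : Γ.H // Γ.ι h = h} + 1) :
    Xor'
      (Fintype.card Γ.V = 2 ∧ Γ.numEdges = 1 ∧ Function.Bijective Γ.legFix)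
      (Fintype.card Γ.V = 1 ∧ Γ.numEdges = 0 ∧
        ∃ s t : S, s ≠ t ∧ Γ.leg s = Γ.leg t ∧
          Set.InjOn Γ.leg {x : S | x ≠ t}) := by
  have hsurj : Function.Surjective Γ.legFix := by
    rintro ⟨h, hh⟩
    obtain ⟨s, hs⟩ := Γ.leg_surj h hh
    exact ⟨s, Subtype.ext hs⟩
  have hle := Fintype.card_le_of_surjective _ hsurj
  have hV := h0.2
  have hE : Γ.numEdges = 1 ∨ Γ.numEdges = 0 := by omega
  rcases hE with hE | hE
  · refine Or.inl ⟨⟨by omega, hE, ?_⟩, fun h => by have := h.2.1; omega⟩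
    exact (Fintype.bijective_iff_surjective_and_card _).2 ⟨hsurj, by omega⟩
  · refine Or.inr ⟨⟨by omega, hE, ?_⟩, fun h => by have := h.2.1; omega⟩
    have hninj : ¬ Function.Injective Γ.legFix := by
      intro hi
      have := Fintype.card_le_of_injective _ hi
      omega
    simp only [Function.Injective, not_forall] at hninj
    obtain ⟨s, t, hst, hne⟩ := hninj
    refine ⟨s, t, hne, congrArg Subtype.val hst, ?_⟩
    have hs2 : Function.Surjective (fun x : {x : S // x ≠ t} => Γ.legFix x.1) := by
      intro h
      obtain ⟨x, hx⟩ := hsurj h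
      by_cases hxt : x = t
      · exact ⟨⟨s, hne⟩, by rw [← hx, hxt]; exact hst⟩
      · exact ⟨⟨x, hxt⟩, hx⟩
    have hc : Fintype.card {x : S // x ≠ t} = Fintype.card S - 1 := by
      simp [Fintype.card_subtype_compl]
    have hb := (Fintype.bijective_iff_surjective_and_card _).2 ⟨hs2, by omega⟩
    intro x hx y hy hxy
    have := @hb.1 ⟨x, hx⟩ ⟨y, hy⟩ (Subtype.ext hxy)
    exact congrArg Subtype.val this
end

section
/- Let T be a finite tree (a connected acyclic simple graph) with vertex set V, let S be a finite set, and let ℓ : S → V be a function such that for every vertex v, deg(v) + #ℓ⁻¹(v) ≥ 3. For an edge e of T with endpoints a and b, deleting e from T leaves exactly two connected components, C_a(e) containing a and C_b(e) containing b; let P(e) denote the unordered pair { {s ∈ S : ℓ(s) ∈ C_a(e)}, {s ∈ S : ℓ(s) ∈ C_b(e)} }, a partition of S into two parts. Then the assignment e ↦ P(e) is injective: distinct edges of T induce distinct partitions of S. -/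
def DD {V : Type} (G : SimpleGraph V) (x y v : V) : Prop :=
  (G.deleteEdges {s(x, y)}).Reachable v x

section aux
variable {V : Type} {G : SimpleGraph V}

lemma DD_self (x y : V) : DD G x y x := SimpleGraph.Reachable.refl _

lemma DD_disj (hT : G.IsTree) {x y v : V} (h : G.Adj x y) (h1 : DD G x y v)
    (h2 : DD G y x v) : False := by
  have hb := (SimpleGraph.isAcyclic_iff_forall_adj_isBridge.1 hT.isAcyclic) h
  rw [SimpleGraph.isBridge_iff] at hb
  unfold DD at h1 h2
  rw [Sym2.eq_swap] at h2
  exact hb (h1.symm.trans h2)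

lemma DD_step {x y u w : V} (h : G.Adj u w) (hne : s(u, w) ≠ s(x, y)) (hu : DD G x y u) :
    DD G x y w := by
  have : (G.deleteEdges {s(x, y)}).Adj w u := by
    rw [SimpleGraph.deleteEdges_adj]
    exact ⟨h.symm, fun hm => hne (Sym2.eq_swap.trans hm)⟩
  exact this.reachable.trans hu

lemma DD_total (hT : G.IsTree) (x y v : V) : DD G x y v ∨ DD G y x v := by
  obtain ⟨p⟩ := hT.connected.preconnected x v
  have key : ∀ u w : V, G.Walk u w → (DD G x y u ∨ DD G y x u) → (DD G x y w ∨ DD G y x w) := by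
    intro u w p
    induction p with
    | nil => exact id
    | cons h p ih =>
      rename_i u w z
      intro hu
      apply ih
      by_cases he : s(u, w) = s(x, y)
      · rcases Sym2.eq_iff.1 he with ⟨rfl, rfl⟩ | ⟨rfl, rfl⟩
        · exact Or.inr (DD_self _ _)
        · exact Or.inl (DD_self _ _)
      · rcases hu with hu | hu
        · exact Or.inl (DD_step h he hu)
        · exact Or.inr (DD_step h (by rwa [Sym2.eq_swap (a := y)]) hu)
  exact key x v p (Or.inl (DD_self _ _))

lemma DD_sub {a b x y : V} (ha : DD G x y a)
    (hx : ¬ DD G a b x ∨ ¬ DD G a b y) {v : V} (hv : DD G a b v) : DD G x y v := by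
  obtain ⟨p⟩ := hv.symm
  have key : ∀ u w : V, (G.deleteEdges {s(a, b)}).Walk u w → DD G a b u → DD G x y u →
      DD G x y w := by
    intro u w p
    induction p with
    | nil => exact fun _ h => h
    | cons h p ih =>
      rename_i u w z
      intro h1 h2
      have hw : DD G a b w := h.symm.reachable.trans h1
      refine ih hw (DD_step (SimpleGraph.deleteEdges_le _ h) ?_ h2)
      intro he
      rcases Sym2.eq_iff.1 he with ⟨rfl, rfl⟩ | ⟨rfl, rfl⟩ <;> tauto
  exact key a v p (DD_self _ _) ha

lemma DD_F2 (hT : G.IsTree) {c x y : V} (hc : G.Adj c x) (hcy : c ≠ y) {v : V}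
    (hv : DD G c x v) : DD G x y v := by
  refine DD_sub (DD_step hc.symm ?_ (DD_self x y)) (Or.inl fun h => DD_disj hT hc h (DD_self _ _)) hv
  intro h
  rcases Sym2.eq_iff.1 h with ⟨_, h⟩ | ⟨_, h⟩
  · exact hcy h
  · exact hc.ne h

lemma exists_two_nbr [Fintype V] [DecidableEq V] [DecidableRel G.Adj] {x y : V}
    (h : 3 ≤ G.degree x) : ∃ c d, G.Adj c x ∧ G.Adj d x ∧ c ≠ y ∧ d ≠ y ∧ c ≠ d := by
  have : 1 < ((G.neighborFinset x).erase y).card := by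
    have := Finset.pred_card_le_card_erase (s := G.neighborFinset x) (a := y)
    rw [SimpleGraph.card_neighborFinset_eq_degree] at this
    omega
  obtain ⟨c, hc, d, hd, hcd⟩ := Finset.one_lt_card.1 this
  simp only [Finset.mem_erase, SimpleGraph.mem_neighborFinset] at hc hd
  exact ⟨c, d, hc.2.symm, hd.2.symm, hc.1, hd.1, hcd⟩

lemma leg_or_deg {S : Type} [Fintype V] [DecidableEq V] [Fintype S] [DecidableRel G.Adj]
    (ℓ : S → V)
    (hdeg : ∀ v : V, 3 ≤ G.degree v + (Finset.univ.filter (fun s : S => ℓ s = v)).card) (x : V) :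
    (∃ s, ℓ s = x) ∨ 3 ≤ G.degree x := by
  by_cases h : ∃ s, ℓ s = x
  · exact Or.inl h
  · right
    have h0 : Finset.univ.filter (fun s : S => ℓ s = x) = ∅ := by
      ext s
      simpa using fun hs => h ⟨s, hs⟩
    have := hdeg x
    rw [h0] at this
    simpa using this

lemma exists_leg {S : Type} [Fintype V] [DecidableEq V] [Fintype S] [DecidableRel G.Adj]
    (hT : G.IsTree) (ℓ : S → V)
    (hdeg : ∀ v : V, 3 ≤ G.degree v + (Finset.univ.filter (fun s : S => ℓ s = v)).card)
    (n : ℕ) : ∀ x y : V, G.Adj x y → {v | DD G x y v}.ncard ≤ n → ∃ s, DD G x y (ℓ s) := by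
  induction n with
  | zero =>
    intro x y _ hn
    have := (Set.ncard_eq_zero (Set.toFinite _)).1 (Nat.le_zero.1 hn)
    exact absurd (show x ∈ {v | DD G x y v} from DD_self x y) (by simp [this])
  | succ n ih =>
    intro x y hxy hn
    rcases leg_or_deg ℓ hdeg x with ⟨s, hs⟩ | h3
    · exact ⟨s, hs ▸ DD_self _ _⟩
    · obtain ⟨c, _, hc, _, hcy, _, _⟩ := exists_two_nbr (y := y) h3
      have hlt : {v | DD G c x v}.ncard < {v | DD G x y v}.ncard := by
        apply Set.ncard_lt_ncard _ (Set.toFinite _)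
        refine ⟨fun v hv => DD_F2 hT hc hcy hv, fun hs => ?_⟩
        exact DD_disj hT hc (hs (show x ∈ {v | DD G x y v} from DD_self x y)) (DD_self _ _)
      obtain ⟨s, hs⟩ := ih c x hc (by omega)
      exact ⟨s, DD_F2 hT hc hcy hs⟩

lemma oriented {S : Type} [Fintype V] [DecidableEq V] [Fintype S] [DecidableRel G.Adj]
    (hT : G.IsTree) (ℓ : S → V)
    (hdeg : ∀ v : V, 3 ≤ G.degree v + (Finset.univ.filter (fun s : S => ℓ s = v)).card)
    {a b x y : V} (hab : G.Adj a b) (hxy : G.Adj x y) (hne : s(a, b) ≠ s(x, y))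
    (ha : DD G x y a) (hx : DD G b a x)
    (hP : (∀ s, DD G a b (ℓ s) ↔ DD G x y (ℓ s)) ∨ (∀ s, DD G a b (ℓ s) ↔ DD G y x (ℓ s))) :
    False := by
  have hx' : ¬ DD G a b x := fun h => DD_disj hT hab h hx
  have hb : DD G x y b := DD_step hab hne ha
  rcases hP with hP | hP
  · rcases leg_or_deg ℓ hdeg b with ⟨s, rfl⟩ | h3
    · exact DD_disj hT hab ((hP s).2 hb) (DD_self _ _)
    · obtain ⟨c, d, hc, hd, hca, hda, hcd⟩ := exists_two_nbr (y := a) h3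
      have main : ∀ c, G.Adj c b → c ≠ a → ¬ DD G c b y → False := by
        intro c hc hca hcy
        obtain ⟨s, hs⟩ := exists_leg hT ℓ hdeg _ c b hc le_rfl
        have h1 := DD_F2 hT hc hca hs
        have hcx : DD G x y c := by
          refine DD_step hc.symm ?_ hb
          intro h
          rcases Sym2.eq_iff.1 h with ⟨rfl, rfl⟩ | ⟨rfl, rfl⟩
          · exact hcy (DD_self _ _)
          · exact DD_disj hT hxy hb (DD_self _ _)
        have h2 := DD_sub hcx (Or.inr hcy) hs
        exact DD_disj hT hab ((hP s).2 h2) h1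
      refine main c hc hca fun h1 => main d hd hda fun h2 => ?_
      exact DD_disj hT hd h2 (DD_F2 hT hc hcd h1)
  · obtain ⟨s, hs⟩ := exists_leg hT ℓ hdeg _ a b hab le_rfl
    exact DD_disj hT hxy (DD_sub ha (Or.inl hx') hs) ((hP s).1 hs)

end aux


/-- Let `T` be a finite tree with vertex set `V`, and `ℓ : S → V` a labeling of a finite
set `S` such that every vertex carries at least three half-edges (incident edges plus legs).
For an edge with endpoints `a, b`, cutting the tree at this edge induces the partition of `S`
into the labels landing in the component of `a` and those landing in the component of `b`.
Then distinct edges induce distinct partitions: if two edges induce the same (unordered)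
partition of `S`, they are the same edge. -/
theorem cut_partition_injective {V S : Type} [Fintype V] [DecidableEq V] [Fintype S]
    (G : SimpleGraph V) [DecidableRel G.Adj] (hT : G.IsTree) (ℓ : S → V)
    (hdeg : ∀ v : V, 3 ≤ G.degree v + (Finset.univ.filter (fun s : S => ℓ s = v)).card)
    (a b a' b' : V) (hab : G.Adj a b) (hab' : G.Adj a' b')
    (hP : ({ {s : S | (G.deleteEdges {s(a, b)}).Reachable (ℓ s) a},
             {s : S | (G.deleteEdges {s(a, b)}).Reachable (ℓ s) b} } : Set (Set S)) =
          ({ {s : S | (G.deleteEdges {s(a', b')}).Reachable (ℓ s) a'},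
             {s : S | (G.deleteEdges {s(a', b')}).Reachable (ℓ s) b'} } : Set (Set S))) :
    s(a, b) = s(a', b') := by
  by_contra hne
  have hP' : ((∀ s, DD G a b (ℓ s) ↔ DD G a' b' (ℓ s)) ∧ (∀ s, DD G b a (ℓ s) ↔ DD G b' a' (ℓ s)))
      ∨ ((∀ s, DD G a b (ℓ s) ↔ DD G b' a' (ℓ s)) ∧ (∀ s, DD G b a (ℓ s) ↔ DD G a' b' (ℓ s))) := by
    unfold DD
    rw [Sym2.eq_swap (a := b), Sym2.eq_swap (a := b')]
    rcases Set.pair_eq_pair_iff.1 hP with ⟨h1, h2⟩ | ⟨h1, h2⟩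
    · exact Or.inl ⟨fun s => Set.ext_iff.1 h1 s, fun s => Set.ext_iff.1 h2 s⟩
    · exact Or.inr ⟨fun s => Set.ext_iff.1 h1 s, fun s => Set.ext_iff.1 h2 s⟩
  clear hP
  have hne2 : s(b, a) ≠ s(a', b') := by rwa [Sym2.eq_swap]
  have hne3 : s(a, b) ≠ s(b', a') := by rwa [Sym2.eq_swap (a := b')]
  have hne4 : s(b, a) ≠ s(b', a') := by rwa [Sym2.eq_swap (a := b')]
  rcases DD_total hT a' b' a with h1 | h1
  · rcases DD_total hT a b a' with h2 | h2
    · exact oriented hT ℓ hdeg hab.symm hab' hne2 (DD_step hab hne h1) h2 (by tauto)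
    · exact oriented hT ℓ hdeg hab hab' hne h1 h2 (by tauto)
  · rcases DD_total hT a b b' with h2 | h2
    · exact oriented hT ℓ hdeg hab.symm hab'.symm hne4 (DD_step hab hne3 h1) h2 (by tauto)
    · exact oriented hT ℓ hdeg hab hab'.symm hne3 h1 h2 (by tauto)
end

section
/- Let 𝒦 be an at least triparted simplicial complex on a finite set S and let s, t, u ∈ S be three distinct elements. Then there exists a genus-0 𝒦-stable graph Γ with ℓ(s) = ℓ(t) = ℓ(u) if and only if {s, t, u} ∈ 𝒦. -/
/-- For an at least triparted simplicial complex `𝒦` on `S` and distinct `s, t, u ∈ S`,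
there exists a genus-0 `𝒦`-stable graph `Γ` with `ℓ(s) = ℓ(t) = ℓ(u)` if and only if
`{s, t, u} ∈ 𝒦`. -/
theorem exists_graph_colliding_three_iff {S : Type} [Fintype S] [DecidableEq S]
    (K : AbsSimplicialComplex S) (hK : K.Triparted)
    (s t u : S) (hst : s ≠ t) (hsu : s ≠ u) (htu : t ≠ u) :
    (∃ Γ : KStableGraph S K, Γ.GenusZero ∧ Γ.leg s = Γ.leg t ∧ Γ.leg t = Γ.leg u) ↔
      ({s, t, u} : Finset S) ∈ K.faces := by
  constructor
  · rintro ⟨Γ, -, h1, h2⟩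
    refine K.down_closed (Γ.fiber_mem (Γ.leg s) (Γ.leg_fixed s)) ?_
    intro x hx
    simp only [Finset.mem_insert, Finset.mem_singleton] at hx
    simp only [Finset.mem_filter, Finset.mem_univ, true_and]
    rcases hx with rfl | rfl | rfl
    · rfl
    · exact h1.symm
    · rw [h1, h2]
  · intro hF
    let leg : S → {x : S // x ≠ t ∧ x ≠ u} := fun x =>
      if h : x ≠ t ∧ x ≠ u then ⟨x, h⟩ else ⟨s, hst, hsu⟩
    have hleg : ∀ h : {x : S // x ≠ t ∧ x ≠ u}, leg h.1 = h := by
      rintro ⟨x, hx⟩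
      simp only [leg, dif_pos hx]
    have hfib : ∀ h : {x : S // x ≠ t ∧ x ≠ u},
        (Finset.univ.filter (fun x : S => leg x = h)) ∈ K.faces := by
      intro h
      by_cases hs : h.1 = s
      · refine K.down_closed hF ?_
        intro x hx
        simp only [Finset.mem_filter, Finset.mem_univ, true_and] at hx
        simp only [Finset.mem_insert, Finset.mem_singleton]
        by_cases hx' : x ≠ t ∧ x ≠ u
        · left
          rw [← hs, ← hx]
          simp only [leg, dif_pos hx']
        · tauto
      · refine K.down_closed (K.singleton_mem h.1) ?_
        intro x hx
        simp only [Finset.mem_filter, Finset.mem_univ, true_and] at hx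
        simp only [Finset.mem_singleton]
        by_cases hx' : x ≠ t ∧ x ≠ u
        · rw [← hx]
          simp only [leg, dif_pos hx']
        · exfalso
          apply hs
          rw [← hx]
          simp only [leg, dif_neg hx']
    have hcard : 3 ≤ Fintype.card {x : S // x ≠ t ∧ x ≠ u} := by
      have h3 := hK (Finset.univ.image
        (fun h => Finset.univ.filter (fun x : S => leg x = h))) ?_ ?_ ?_ ?_
      · exact h3.trans Finset.card_image_le
      · intro A hA
        obtain ⟨h, -, rfl⟩ := Finset.mem_image.1 hA
        exact ⟨h.1, by simp [hleg]⟩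
      · intro A hA
        obtain ⟨h, -, rfl⟩ := Finset.mem_image.1 hA
        exact hfib h
      · intro A hA B hB hAB
        obtain ⟨h, -, rfl⟩ := Finset.mem_image.1 hA
        obtain ⟨k, -, rfl⟩ := Finset.mem_image.1 hB
        rw [Finset.disjoint_left]
        intro x hx hx'
        simp only [Finset.mem_filter, Finset.mem_univ, true_and] at hx hx'
        exact hAB (by rw [← hx, ← hx'])
      · ext x
        simp only [Finset.mem_sup, Finset.mem_univ, iff_true]
        exact ⟨_, Finset.mem_image_of_mem _ (Finset.mem_univ (leg x)), by simp⟩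
    have huniv : (Finset.univ : Finset S) ∉ K.faces := by
      intro hU
      have h3 := hK {Finset.univ} ?_ ?_ ?_ ?_
      · simp at h3
      · intro A hA
        rw [Finset.mem_singleton.1 hA]
        exact ⟨s, Finset.mem_univ s⟩
      · intro A hA
        rw [Finset.mem_singleton.1 hA]
        exact hU
      · intro A hA B hB hAB
        exact absurd ((Finset.mem_singleton.1 hA).trans (Finset.mem_singleton.1 hB).symm) hAB
      · simp
    refine ⟨{
      V := Unit
      H := {x : S // x ≠ t ∧ x ≠ u}
      g := fun _ => 0
      f := fun _ => ()
      ι := id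
      ι_invol := fun _ => rfl
      leg := leg
      leg_fixed := fun _ => rfl
      leg_surj := fun h _ => ⟨h.1, hleg h⟩
      conn := ?_
      fiber_mem := fun h _ => hfib h
      leaf_cond := ?_
      stable := ?_ }, ⟨fun _ => rfl, ?_⟩, ?_, ?_⟩
    · exact ⟨fun a b => by cases a; cases b; exact SimpleGraph.Reachable.refl _⟩
    · intro v _
      simpa using huniv
    · intro v
      have : (Finset.univ.filter (fun h : {x : S // x ≠ t ∧ x ≠ u} => () = v)).card
          = Fintype.card {x : S // x ≠ t ∧ x ≠ u} := by simp
      rw [this]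
      push_cast
      omega
    · simp [KStableGraph.numEdges]
    · simp [leg, hst, hsu]
    · simp [leg]
end

section
/- Let 𝒦 be an at least triparted simplicial complex on a finite set S and let I ⊆ S with I ∉ 𝒦 and S ∖ I ∉ 𝒦. Then 2 ≤ #I ≤ #S − 2, and there exists a genus-0 𝒦-stable graph Γ with exactly two vertices v₁ and v₂ joined by exactly one edge, with ℓ : S → H^ι a bijection, such that {s ∈ S : ℓ(s) ∈ H(v₁)} = I and {s ∈ S : ℓ(s) ∈ H(v₂)} = S ∖ I. (Such a graph indexes the boundary divisor D_I of M̄_{0,𝒦}.) -/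
theorem two_le_of_not_face {S : Type} [Fintype S] [DecidableEq S]
    (K : AbsSimplicialComplex S) (I : Finset S) (hI : I ∉ K.faces) : 2 ≤ I.card := by
  by_contra h
  have h1 : I.card = 0 ∨ I.card = 1 := by omega
  rcases h1 with h0 | h1
  · rw [Finset.card_eq_zero] at h0
    exact hI (h0 ▸ K.empty_mem)
  · obtain ⟨a, rfl⟩ := Finset.card_eq_one.1 h1
    exact hI (K.singleton_mem a)

/-- The two-vertex graph. -/
def DIGraph {S : Type} [Fintype S] [DecidableEq S]
    (K : AbsSimplicialComplex S)
    (I : Finset S) (hI : I ∉ K.faces) (hIc : Iᶜ ∉ K.faces) : KStableGraph S K where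
  V := Bool
  H := S ⊕ Bool
  g := fun _ => 0
  f := Sum.elim (fun s => decide (s ∈ I)) id
  ι := Sum.map id not
  ι_invol := by rintro (s | b) <;> simp
  leg := Sum.inl
  leg_fixed := by simp
  leg_surj := by rintro (s | b) <;> simp
  conn := by
    have h : (SimpleGraph.fromRel (fun v w : Bool => ∃ h : S ⊕ Bool,
        Sum.elim (fun s => decide (s ∈ I)) id h = v ∧
        Sum.elim (fun s => decide (s ∈ I)) id (Sum.map id not h) = w)) = ⊤ := by
      ext v w
      simp only [SimpleGraph.fromRel_adj, SimpleGraph.top_adj, and_iff_left_iff_imp]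
      intro hvw
      refine Or.inl ⟨Sum.inr v, rfl, ?_⟩
      cases v <;> cases w <;> simp_all
    rw [h]
    exact SimpleGraph.connected_top
  fiber_mem := by
    rintro (s | b) h
    · have : (Finset.univ.filter (fun t : S => (Sum.inl t : S ⊕ Bool) = Sum.inl s)) = {s} := by
        ext t; simp
      rw [this]; exact K.singleton_mem s
    · simp at h
  leaf_cond := by
    rintro (_ | _) -
    · have : (Finset.univ.filter (fun s : S =>
          Sum.elim (fun s => decide (s ∈ I)) id (Sum.inl s : S ⊕ Bool) = false)) = Iᶜ := by
        ext t; simp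
      rw [this]; exact hIc
    · have : (Finset.univ.filter (fun s : S =>
          Sum.elim (fun s => decide (s ∈ I)) id (Sum.inl s : S ⊕ Bool) = true)) = I := by
        ext t; simp
      rw [this]; exact hI
  stable := by
    have h1 := two_le_of_not_face K I hI
    have h2 := two_le_of_not_face K Iᶜ hIc
    rintro (_ | _)
    · have : (Finset.univ.filter (fun h : S ⊕ Bool =>
          Sum.elim (fun s => decide (s ∈ I)) id h = false)) = Iᶜ.disjSum {false} := by
        ext (t | t) <;> simp
      rw [this, Finset.card_disjSum, Finset.card_singleton]
      push_cast
      omega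
    · have : (Finset.univ.filter (fun h : S ⊕ Bool =>
          Sum.elim (fun s => decide (s ∈ I)) id h = true)) = I.disjSum {true} := by
        ext (t | t) <;> simp
      rw [this, Finset.card_disjSum, Finset.card_singleton]
      push_cast
      omega

theorem DIGraph_numEdges {S : Type} [Fintype S] [DecidableEq S]
    (K : AbsSimplicialComplex S)
    (I : Finset S) (hI : I ∉ K.faces) (hIc : Iᶜ ∉ K.faces) :
    (DIGraph K I hI hIc).numEdges = 1 := by
  have : (Finset.univ.filter (fun h : S ⊕ Bool => Sum.map id not h ≠ h)) =
      (∅ : Finset S).disjSum (Finset.univ : Finset Bool) := by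
    ext (t | t) <;> simp
  change (Finset.univ.filter (fun h : S ⊕ Bool => Sum.map id not h ≠ h)).card / 2 = 1
  rw [this, Finset.card_disjSum]
  simp

/-- Let `𝒦` be an at least triparted simplicial complex on `S` and `I ⊆ S` with `I ∉ 𝒦`
and `S ∖ I ∉ 𝒦`. Then `2 ≤ #I ≤ #S − 2`, and there exists a genus-0 `𝒦`-stable graph with
exactly two vertices `v₁ ≠ v₂` joined by exactly one edge, with `ℓ : S → H^ι` a bijection,
such that the markings at `v₁` are exactly `I` and the markings at `v₂` are exactly `S ∖ I`
(the graph indexing the boundary divisor `D_I`). -/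
theorem exists_DI_divisor_graph {S : Type} [Fintype S] [DecidableEq S]
    (K : AbsSimplicialComplex S) (hK : K.Triparted)
    (I : Finset S) (hI : I ∉ K.faces) (hIc : Iᶜ ∉ K.faces) :
    (2 ≤ I.card ∧ I.card + 2 ≤ Fintype.card S) ∧
    ∃ Γ : KStableGraph S K, Γ.GenusZero ∧
      ∃ v₁ v₂ : Γ.V, v₁ ≠ v₂ ∧
        Fintype.card Γ.V = 2 ∧ Γ.numEdges = 1 ∧
        Function.Bijective Γ.legFix ∧
        Finset.univ.filter (fun s : S => Γ.f (Γ.leg s) = v₁) = I ∧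
        Finset.univ.filter (fun s : S => Γ.f (Γ.leg s) = v₂) = Iᶜ := by
  have h1 := two_le_of_not_face K I hI
  have h2 := two_le_of_not_face K Iᶜ hIc
  have h3 := Finset.card_add_card_compl I
  refine ⟨⟨h1, by omega⟩, DIGraph K I hI hIc, ⟨fun _ => rfl, ?_⟩, true, false, ?_, ?_, ?_, ?_, ?_, ?_⟩
  · rw [DIGraph_numEdges]; exact Fintype.card_bool
  · exact Bool.noConfusion
  · exact Fintype.card_bool
  · exact DIGraph_numEdges K I hI hIc
  · constructor
    · intro a b h
      exact Sum.inl_injective (congrArg Subtype.val h)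
    · rintro ⟨h, hh⟩
      obtain ⟨s, hs⟩ := (DIGraph K I hI hIc).leg_surj h hh
      exact ⟨s, Subtype.ext hs⟩
  · ext t
    refine (@Finset.mem_filter S _ (_) _ _).trans ?_
    change _ ∧ decide (t ∈ I) = true ↔ _
    simp
  · ext t
    refine (@Finset.mem_filter S _ (_) _ _).trans ?_
    change _ ∧ decide (t ∈ I) = false ↔ _
    simp
end
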